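/- Suppose the data contain at least one interior group (1 ≤ k_y ≤ k), let f be a probability density on (0,∞), and suppose the k_y×m matrix X_y whose rows are the covariate vectors x_jᵀ of the interior groups satisfies rank(X_y) = m. Then ∫_{ℝ^m} ∫_0^∞ f(r) · L(r, β) dr dβ < ∞, i.e., the posterior under a proper hyper-prior on r and a flat improper hyper-prior on β is proper; the extreme groups play no role in this sufficient condition. -/

import Mathlib

open MeasureTheory Real Filter Finset

/-- The Beta function `B(a,b) = ∫₀¹ v^(a-1) (1-v)^(b-1) dv`. -/
noncomputable def betaFn (a b : ℝ) : ℝ :=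
  ∫ v in (0:ℝ)..1, v ^ (a - 1) * (1 - v) ^ (b - 1)

/-- The standard logistic function `σ(t) = exp t / (1 + exp t)`. -/
noncomputable def logistic (t : ℝ) : ℝ := Real.exp t / (1 + Real.exp t)

/-- Expected random effect `p_j^E(β) = σ(x_jᵀ β)`. -/
noncomputable def pE {k m : ℕ} (x : Fin k → Fin m → ℝ) (j : Fin k) (β : Fin m → ℝ) : ℝ :=
  logistic (∑ i, x j i * β i)

/-- The Beta-Binomial likelihood
`L(r,β) = ∏ⱼ C(nⱼ,yⱼ) B(yⱼ + r pⱼᴱ, nⱼ - yⱼ + r qⱼᴱ) / B(r pⱼᴱ, r qⱼᴱ)`. -/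
noncomputable def bbL {k m : ℕ} (x : Fin k → Fin m → ℝ) (n y : Fin k → ℕ)
    (r : ℝ) (β : Fin m → ℝ) : ℝ :=
  ∏ j : Fin k,
    ((n j).choose (y j) : ℝ) *
      betaFn ((y j : ℝ) + r * pE x j β) (((n j : ℝ) - (y j : ℝ)) + r * (1 - pE x j β)) /
      betaFn (r * pE x j β) (r * (1 - pE x j β))

theorem intervalIntegrable_betaFn {a b : ℝ} (ha : 0 < a) (hb : 0 < b) :
    IntervalIntegrable (fun v : ℝ => v ^ (a - 1) * (1 - v) ^ (b - 1)) volume 0 1 := by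
  have h := Complex.betaIntegral_convergent (u := (a : ℂ)) (v := (b : ℂ))
    (by simpa using ha) (by simpa using hb)
  rw [intervalIntegrable_iff_integrableOn_Ioo_of_le zero_le_one] at h ⊢
  refine (integrableOn_congr_fun (fun v hv => ?_) measurableSet_Ioo).1 h.re
  have h0 : 0 ≤ v := hv.1.le
  have h1 : 0 ≤ 1 - v := by linarith [hv.2]
  rw [← Complex.ofReal_one, ← Complex.ofReal_sub, ← Complex.ofReal_sub, ← Complex.ofReal_sub,
    ← Complex.ofReal_cpow h0, ← Complex.ofReal_cpow h1, ← Complex.ofReal_mul]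
  exact Complex.ofReal_re _

theorem betaFn_eq_beta {a b : ℝ} (ha : 0 < a) (hb : 0 < b) :
    betaFn a b = ProbabilityTheory.beta a b := by
  rw [ProbabilityTheory.beta_eq_betaIntegralReal a b ha hb]
  have h : Complex.betaIntegral a b = (betaFn a b : ℂ) := by
    rw [Complex.betaIntegral, betaFn, ← intervalIntegral.integral_ofReal]
    refine intervalIntegral.integral_congr fun v hv => ?_
    rw [Set.uIcc_of_le zero_le_one] at hv
    have h1 : 0 ≤ 1 - v := by linarith [hv.2]
    simp only [Complex.ofReal_mul]
    rw [Complex.ofReal_cpow hv.1, Complex.ofReal_cpow h1]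
    push_cast
    rfl
  rw [h, Complex.ofReal_re]

theorem betaFn_pos {a b : ℝ} (ha : 0 < a) (hb : 0 < b) : 0 < betaFn a b := by
  rw [betaFn_eq_beta ha hb]
  exact ProbabilityTheory.beta_pos ha hb

theorem betaFn_le_betaFn {a b a' b' : ℝ} (ha : 0 < a) (hb : 0 < b) (haa' : a ≤ a')
    (hbb' : b ≤ b') : betaFn a' b' ≤ betaFn a b := by
  refine intervalIntegral.integral_mono_on_of_le_Ioo zero_le_one
    (intervalIntegrable_betaFn (ha.trans_le haa') (hb.trans_le hbb'))
    (intervalIntegrable_betaFn ha hb) fun v hv => ?_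
  have h1 : 0 < 1 - v := by linarith [hv.2]
  exact mul_le_mul
    (Real.rpow_le_rpow_of_exponent_ge hv.1 hv.2.le (by linarith))
    (Real.rpow_le_rpow_of_exponent_ge h1 (by linarith [hv.1]) (by linarith))
    (Real.rpow_nonneg h1.le _) (Real.rpow_nonneg hv.1.le _)

theorem betaFn_add_one_add_one {a b : ℝ} (ha : 0 < a) (hb : 0 < b) :
    betaFn (a + 1) (b + 1) = a * b / ((a + b) * (a + b + 1)) * betaFn a b := by
  have hab : 0 < a + b := by positivity
  rw [betaFn_eq_beta ha hb, betaFn_eq_beta (by positivity) (by positivity)]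
  simp only [ProbabilityTheory.beta]
  rw [show a + 1 + (b + 1) = a + b + 1 + 1 by ring, Real.Gamma_add_one ha.ne',
    Real.Gamma_add_one hb.ne', Real.Gamma_add_one (by positivity : a + b + 1 ≠ 0),
    Real.Gamma_add_one hab.ne']
  have := (Real.Gamma_pos_of_pos hab).ne'
  field_simp

theorem logistic_pos (t : ℝ) : 0 < logistic t := by
  unfold logistic
  positivity

theorem one_sub_logistic_pos (t : ℝ) : 0 < 1 - logistic t := by
  have h : 1 - logistic t = 1 / (1 + Real.exp t) := by
    unfold logistic
    field_simp
    ring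
  rw [h]
  positivity

theorem logistic_mul_one_sub_le (t : ℝ) :
    logistic t * (1 - logistic t) ≤ Real.exp (-|t|) := by
  have he := Real.exp_pos t
  have h : logistic t * (1 - logistic t) = Real.exp t / (1 + Real.exp t) ^ 2 := by
    unfold logistic
    field_simp
    ring
  rw [h, div_le_iff₀ (by positivity)]
  rcases abs_cases t with ⟨ht, _⟩ | ⟨ht, _⟩
  · rw [ht, Real.exp_neg, ← div_eq_inv_mul, le_div_iff₀ he]
    nlinarith
  · rw [ht, neg_neg]
    nlinarith [mul_pos he he, mul_pos (mul_pos he he) he]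

theorem betaFn_ratio_nonneg {r p a b : ℝ} (hr : 0 < r) (hp : 0 < p) (hq : 0 < 1 - p)
    (ha : 0 ≤ a) (hb : 0 ≤ b) :
    0 ≤ betaFn (a + r * p) (b + r * (1 - p)) / betaFn (r * p) (r * (1 - p)) :=
  div_nonneg (betaFn_pos (by positivity) (by positivity)).le
    (betaFn_pos (by positivity) (by positivity)).le

theorem betaFn_ratio_le_one {r p a b : ℝ} (hr : 0 < r) (hp : 0 < p) (hq : 0 < 1 - p)
    (ha : 0 ≤ a) (hb : 0 ≤ b) :
    betaFn (a + r * p) (b + r * (1 - p)) / betaFn (r * p) (r * (1 - p)) ≤ 1 := by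
  rw [div_le_one (betaFn_pos (by positivity) (by positivity))]
  exact betaFn_le_betaFn (by positivity) (by positivity) (by linarith) (by linarith)

theorem betaFn_ratio_le_mul {r p a b : ℝ} (hr : 0 < r) (hp : 0 < p) (hq : 0 < 1 - p)
    (ha : 1 ≤ a) (hb : 1 ≤ b) :
    betaFn (a + r * p) (b + r * (1 - p)) / betaFn (r * p) (r * (1 - p)) ≤ p * (1 - p) := by
  have hrp : 0 < r * p := by positivity
  have hrq : 0 < r * (1 - p) := by positivity
  have hB := betaFn_pos hrp hrq
  rw [div_le_iff₀ hB]
  refine (betaFn_le_betaFn (a := r * p + 1) (b := r * (1 - p) + 1) (by positivity)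
    (by positivity) (by linarith) (by linarith)).trans ?_
  rw [betaFn_add_one_add_one hrp hrq]
  refine mul_le_mul_of_nonneg_right ?_ hB.le
  rw [show r * p + r * (1 - p) = r by ring, div_le_iff₀ (by positivity)]
  nlinarith [mul_pos (mul_pos hp hq) hr]

/-- The likelihood decays exponentially in the linear predictors of the interior groups,
uniformly in `r`. -/
theorem bbL_le {k m : ℕ} (x : Fin k → Fin m → ℝ) (n y : Fin k → ℕ) (hy : ∀ j, y j ≤ n j)
    {r : ℝ} (hr : 0 < r) (β : Fin m → ℝ) :
    bbL x n y r β ≤ (∏ j, ((n j).choose (y j) : ℝ)) *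
      Real.exp (-∑ j : {j : Fin k // 1 ≤ y j ∧ y j ≤ n j - 1}, |∑ i, x j.1 i * β i|) := by
  have hsum : ∑ j : {j : Fin k // 1 ≤ y j ∧ y j ≤ n j - 1}, |∑ i, x j.1 i * β i| =
      ∑ j : Fin k, if 1 ≤ y j ∧ y j ≤ n j - 1 then |∑ i, x j i * β i| else 0 := by
    rw [← Finset.sum_filter]
    exact (Finset.sum_subtype _ (by simp) fun j => |∑ i, x j i * β i|).symm
  rw [hsum, ← Finset.sum_neg_distrib, Real.exp_sum, ← Finset.prod_mul_distrib, bbL]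
  have hp : ∀ j, 0 < pE x j β := fun j => logistic_pos _
  have hq : ∀ j, 0 < 1 - pE x j β := fun j => one_sub_logistic_pos _
  have hny : ∀ j, (0 : ℝ) ≤ (n j : ℝ) - y j := fun j => by
    simpa using (Nat.cast_le (α := ℝ)).2 (hy j)
  refine Finset.prod_le_prod (fun j _ => ?_) fun j _ => ?_
  · rw [mul_div_assoc]
    exact mul_nonneg (Nat.cast_nonneg _)
      (betaFn_ratio_nonneg hr (hp j) (hq j) (Nat.cast_nonneg _) (hny j))
  · rw [mul_div_assoc]
    refine mul_le_mul_of_nonneg_left ?_ (Nat.cast_nonneg _)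
    split_ifs with h
    · refine (betaFn_ratio_le_mul hr (hp j) (hq j) (by exact_mod_cast h.1) ?_).trans
        (logistic_mul_one_sub_le _)
      have : y j + 1 ≤ n j := by omega
      have : (y j : ℝ) + 1 ≤ n j := by exact_mod_cast this
      linarith
    · simpa using betaFn_ratio_le_one hr (hp j) (hq j) (Nat.cast_nonneg _) (hny j)

theorem integrable_exp_neg_mul_norm {E : Type*} [NormedAddCommGroup E] [NormedSpace ℝ E]
    [FiniteDimensional ℝ E] [MeasurableSpace E] [BorelSpace E] (μ : Measure E)
    [μ.IsAddHaarMeasure] {c : ℝ} (hc : 0 < c) :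
    Integrable (fun v : E => Real.exp (-(c * ‖v‖))) μ := by
  set s := Module.finrank ℝ E + 1 with hs
  have hint : Integrable (fun v : E => (1 + ‖v‖) ^ (-(s : ℝ))) μ :=
    integrable_one_add_norm (by simp [hs])
  refine (hint.const_mul (Real.exp c * s.factorial / c ^ s)).mono'
    (by fun_prop) (Eventually.of_forall fun v => ?_)
  have hv : 0 < 1 + ‖v‖ := by positivity
  have h := Real.pow_div_factorial_le_exp (x := c * (1 + ‖v‖)) (by positivity) s
  rw [Real.norm_of_nonneg (Real.exp_pos _).le, Real.rpow_neg hv.le, Real.rpow_natCast,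
    Real.exp_neg, ← div_eq_mul_inv, div_div, inv_eq_one_div,
    div_le_div_iff₀ (Real.exp_pos _) (by positivity), one_mul, ← mul_pow,
    mul_right_comm, ← Real.exp_add]
  rw [div_le_iff₀ (by positivity)] at h
  convert h using 3
  ring

/-- A matrix of full column rank bounds the norm of a vector by the size of its image. -/
theorem Matrix.exists_mul_norm_le_sum_abs_mulVec {ι κ : Type*} [Fintype ι] [Fintype κ]
    (A : Matrix ι κ ℝ) (hA : A.rank = Fintype.card κ) :
    ∃ c > 0, ∀ v : κ → ℝ, c * ‖v‖ ≤ ∑ i, |(A.mulVec v) i| := by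
  have hker : LinearMap.ker A.mulVecLin = ⊥ := by
    have h := A.mulVecLin.finrank_range_add_finrank_ker
    rw [Module.finrank_fintype_fun_eq_card] at h
    rw [← Submodule.finrank_eq_zero (R := ℝ)]
    rw [Matrix.rank] at hA
    omega
  obtain ⟨K, hK, hanti⟩ := A.mulVecLin.exists_antilipschitzWith hker
  refine ⟨(K : ℝ)⁻¹, by positivity, fun v => ?_⟩
  rw [inv_mul_le_iff₀ (by positivity)]
  refine (ZeroHomClass.bound_of_antilipschitz _ hanti v).trans ?_
  refine mul_le_mul_of_nonneg_left ?_ K.coe_nonneg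
  refine (pi_norm_le_iff_of_nonneg (by positivity)).2 fun i => ?_
  exact Finset.single_le_sum (f := fun i => |(A.mulVec v) i|) (fun _ _ => abs_nonneg _)
    (Finset.mem_univ i)

/-- Theorem 1 + Corollary 1: at least one interior group, proper hyper-prior density `f`
on `(0,∞)`, flat improper prior on `β`. If the covariate matrix `X_y` of the interior
groups has full rank `m`, the posterior is proper (extreme groups play no role). -/
theorem posterior_proper_proper_r_flat_beta_mixed (k m : ℕ) (x : Fin k → Fin m → ℝ)
    (n y : Fin k → ℕ) (hn : ∀ j, 1 ≤ n j) (hy : ∀ j, y j ≤ n j)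
    (hky : 1 ≤ (Finset.univ.filter fun j => 1 ≤ y j ∧ y j ≤ n j - 1).card)
    (hrank :
      (Matrix.of fun j : {j : Fin k // 1 ≤ y j ∧ y j ≤ n j - 1} => x j.1).rank = m)
    (f : ℝ → ℝ) (hfm : Measurable f) (hf0 : ∀ r, 0 ≤ f r)
    (hf1 : ∫⁻ r in Set.Ioi (0:ℝ), ENNReal.ofReal (f r) = 1) :
    (∫⁻ β : Fin m → ℝ, ∫⁻ r in Set.Ioi (0:ℝ),
        ENNReal.ofReal (f r * bbL x n y r β)) < ⊤ := by
  obtain ⟨c, hc, hbound⟩ := Matrix.exists_mul_norm_le_sum_abs_mulVec _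
    (hrank.trans (Fintype.card_fin m).symm)
  set C : ℝ := ∏ j, ((n j).choose (y j) : ℝ)
  have hC : 0 ≤ C := Finset.prod_nonneg fun _ _ => Nat.cast_nonneg _
  have hL : ∀ β : Fin m → ℝ, ∀ r ∈ Set.Ioi (0 : ℝ),
      bbL x n y r β ≤ C * Real.exp (-(c * ‖β‖)) := fun β r hr =>
    (bbL_le x n y hy hr β).trans <|
      mul_le_mul_of_nonneg_left (Real.exp_le_exp.2 (neg_le_neg (hbound β))) hC
  have hint := (integrable_exp_neg_mul_norm (volume : Measure (Fin m → ℝ)) hc).const_mul C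
  refine lt_of_le_of_lt (lintegral_mono fun β => ?_) hint.lintegral_lt_top
  calc ∫⁻ r in Set.Ioi (0:ℝ), ENNReal.ofReal (f r * bbL x n y r β)
      ≤ ∫⁻ r in Set.Ioi (0:ℝ),
          ENNReal.ofReal (f r) * ENNReal.ofReal (C * Real.exp (-(c * ‖β‖))) := by
        refine setLIntegral_mono' measurableSet_Ioi fun r hr => ?_
        rw [← ENNReal.ofReal_mul (hf0 r)]
        exact ENNReal.ofReal_le_ofReal (mul_le_mul_of_nonneg_left (hL β r hr) (hf0 r))
    _ = ENNReal.ofReal (C * Real.exp (-(c * ‖β‖))) := by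
        rw [lintegral_mul_const _ hfm.ennreal_ofReal, hf1, one_mul]
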